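/- arXiv:2307.10093 — 10 statements merged into one kernel-verified Lean document; each statement's English description precedes it below -/
import Mathlib

section
/- (Interpolation, α → 0.) For fixed data matrices X ∈ ℝ^{n×d}, Y ∈ ℝ^{m×d'}, fixed D_X ∈ ℝ^{n×n}, D_Y ∈ ℝ^{m×m}, and fixed probability vectors μ, ν, μ', ν', the function α ↦ AGW_α(X,Y) tends to COOT(X,Y) as α → 0 within the interval [0,1]. -/
open Finset Matrix

/-- A probability vector: nonnegative entries summing to 1. -/
def IsProbVec {n : ℕ} (μ : Fin n → ℝ) : Prop :=
  (∀ i, 0 ≤ μ i) ∧ ∑ i, μ i = 1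

/-- The set of couplings Π(μ,ν): nonnegative matrices with row sums μ and column sums ν. -/
def Couplings {n m : ℕ} (μ : Fin n → ℝ) (ν : Fin m → ℝ) :
    Set (Matrix (Fin n) (Fin m) ℝ) :=
  {Γ | (∀ i j, 0 ≤ Γ i j) ∧ (∀ i, ∑ j, Γ i j = μ i) ∧ (∀ j, ∑ i, Γ i j = ν j)}

/-- The Gromov–Wasserstein loss of a coupling Γ. -/
def LGW {n m : ℕ} (DX : Matrix (Fin n) (Fin n) ℝ) (DY : Matrix (Fin m) (Fin m) ℝ)
    (Γ : Matrix (Fin n) (Fin m) ℝ) : ℝ :=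
  ∑ i, ∑ k, ∑ j, ∑ l, (DX i k - DY j l) ^ 2 * Γ i j * Γ k l

/-- The CO-Optimal Transport loss of a sample coupling Γs and a feature coupling Γv. -/
def LCOOT {n m d d' : ℕ} (X : Matrix (Fin n) (Fin d) ℝ) (Y : Matrix (Fin m) (Fin d') ℝ)
    (Γs : Matrix (Fin n) (Fin m) ℝ) (Γv : Matrix (Fin d) (Fin d') ℝ) : ℝ :=
  ∑ i, ∑ j, ∑ k, ∑ l, (X i k - Y j l) ^ 2 * Γs i j * Γv k l

/-- The Gromov–Wasserstein value. -/
noncomputable def GWval {n m : ℕ} (DX : Matrix (Fin n) (Fin n) ℝ)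
    (DY : Matrix (Fin m) (Fin m) ℝ) (μ : Fin n → ℝ) (ν : Fin m → ℝ) : ℝ :=
  sInf {v : ℝ | ∃ Γ ∈ Couplings μ ν, v = LGW DX DY Γ}

/-- The CO-Optimal Transport value. -/
noncomputable def COOTval {n m d d' : ℕ} (X : Matrix (Fin n) (Fin d) ℝ)
    (Y : Matrix (Fin m) (Fin d') ℝ) (μ : Fin n → ℝ) (ν : Fin m → ℝ)
    (μ' : Fin d → ℝ) (ν' : Fin d' → ℝ) : ℝ :=
  sInf {v : ℝ | ∃ Γs ∈ Couplings μ ν, ∃ Γv ∈ Couplings μ' ν', v = LCOOT X Y Γs Γv}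

/-- The augmented Gromov–Wasserstein value. -/
noncomputable def AGWval {n m d d' : ℕ} (α : ℝ) (X : Matrix (Fin n) (Fin d) ℝ)
    (Y : Matrix (Fin m) (Fin d') ℝ) (DX : Matrix (Fin n) (Fin n) ℝ)
    (DY : Matrix (Fin m) (Fin m) ℝ) (μ : Fin n → ℝ) (ν : Fin m → ℝ)
    (μ' : Fin d → ℝ) (ν' : Fin d' → ℝ) : ℝ :=
  sInf {v : ℝ | ∃ Γs ∈ Couplings μ ν, ∃ Γv ∈ Couplings μ' ν',
    v = α * LGW DX DY Γs + (1 - α) * LCOOT X Y Γs Γv}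

theorem agw_coupling_le_one {n m : ℕ} {μ : Fin n → ℝ} {ν : Fin m → ℝ} (hμ : IsProbVec μ)
    {Γ : Matrix (Fin n) (Fin m) ℝ} (h : Γ ∈ Couplings μ ν) (i : Fin n) (j : Fin m) :
    Γ i j ≤ 1 := by
  obtain ⟨h0, h1, _⟩ := h
  have a : Γ i j ≤ ∑ j, Γ i j :=
    Finset.single_le_sum (f := fun j => Γ i j) (fun j _ => h0 i j) (Finset.mem_univ j)
  have b : μ i ≤ ∑ i, μ i :=
    Finset.single_le_sum (f := μ) (fun j _ => hμ.1 j) (Finset.mem_univ i)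
  rw [h1] at a
  rw [hμ.2] at b
  exact a.trans b

theorem agw_coupling_nonempty {n m : ℕ} {μ : Fin n → ℝ} {ν : Fin m → ℝ} (hμ : IsProbVec μ)
    (hν : IsProbVec ν) : ∃ Γ, Γ ∈ Couplings μ ν := by
  refine ⟨fun i j => μ i * ν j, fun i j => mul_nonneg (hμ.1 i) (hν.1 j), fun i => ?_, fun j => ?_⟩
  · rw [← Finset.mul_sum, hν.2, mul_one]
  · rw [← Finset.sum_mul, hμ.2, one_mul]

theorem agw_tendsto_coot {n m d d' : ℕ}
    (X : Matrix (Fin n) (Fin d) ℝ) (Y : Matrix (Fin m) (Fin d') ℝ)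
    (DX : Matrix (Fin n) (Fin n) ℝ) (DY : Matrix (Fin m) (Fin m) ℝ)
    (μ : Fin n → ℝ) (ν : Fin m → ℝ) (μ' : Fin d → ℝ) (ν' : Fin d' → ℝ)
    (hμ : IsProbVec μ) (hν : IsProbVec ν) (hμ' : IsProbVec μ') (hν' : IsProbVec ν') :
    Filter.Tendsto (fun α : ℝ => AGWval α X Y DX DY μ ν μ' ν')
      (nhdsWithin 0 (Set.Icc (0 : ℝ) 1)) (nhds (COOTval X Y μ ν μ' ν')) := by
  set C : ℝ := ∑ i, ∑ k, ∑ j, ∑ l, (DX i k - DY j l) ^ 2 with hC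
  have hG0 : ∀ Γ ∈ Couplings μ ν, 0 ≤ LGW DX DY Γ := fun Γ h =>
    Finset.sum_nonneg fun i _ => Finset.sum_nonneg fun k _ => Finset.sum_nonneg fun j _ =>
      Finset.sum_nonneg fun l _ => mul_nonneg (mul_nonneg (sq_nonneg _) (h.1 _ _)) (h.1 _ _)
  have hGC : ∀ Γ ∈ Couplings μ ν, LGW DX DY Γ ≤ C := fun Γ h =>
    Finset.sum_le_sum fun i _ => Finset.sum_le_sum fun k _ => Finset.sum_le_sum fun j _ =>
      Finset.sum_le_sum fun l _ => by
        have h1 := agw_coupling_le_one hμ h i j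
        have h2 := agw_coupling_le_one hμ h k l
        rw [mul_assoc]
        exact mul_le_of_le_one_right (sq_nonneg _) (mul_le_one₀ h1 (h.1 _ _) h2)
  have hL0 : ∀ Γ ∈ Couplings μ ν, ∀ Γv ∈ Couplings μ' ν', 0 ≤ LCOOT X Y Γ Γv := fun Γ h Γv h' =>
    Finset.sum_nonneg fun i _ => Finset.sum_nonneg fun k _ => Finset.sum_nonneg fun j _ =>
      Finset.sum_nonneg fun l _ => mul_nonneg (mul_nonneg (sq_nonneg _) (h.1 _ _)) (h'.1 _ _)
  obtain ⟨P, hP⟩ := agw_coupling_nonempty hμ hν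
  obtain ⟨Q, hQ⟩ := agw_coupling_nonempty hμ' hν'
  have lower : ∀ α ∈ Set.Icc (0 : ℝ) 1,
      (1 - α) * COOTval X Y μ ν μ' ν' ≤ AGWval α X Y DX DY μ ν μ' ν' := by
    intro α hα
    refine le_csInf ⟨_, P, hP, Q, hQ, rfl⟩ ?_
    rintro v ⟨Γ, h, Γv, h', rfl⟩
    have h1 : COOTval X Y μ ν μ' ν' ≤ LCOOT X Y Γ Γv := by
      refine csInf_le ⟨0, ?_⟩ ⟨Γ, h, Γv, h', rfl⟩
      rintro v ⟨Γ, h, Γv, h', rfl⟩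
      exact hL0 Γ h Γv h'
    have h2 := mul_le_mul_of_nonneg_left h1 (sub_nonneg.2 hα.2)
    have h3 := mul_nonneg hα.1 (hG0 Γ h)
    linarith
  have upper : ∀ α ∈ Set.Icc (0 : ℝ) 1,
      AGWval α X Y DX DY μ ν μ' ν' ≤ α * C + COOTval X Y μ ν μ' ν' := by
    intro α hα
    rw [← sub_le_iff_le_add']
    refine le_csInf ⟨_, P, hP, Q, hQ, rfl⟩ ?_
    rintro v ⟨Γ, h, Γv, h', rfl⟩
    have h1 : AGWval α X Y DX DY μ ν μ' ν' ≤ α * LGW DX DY Γ + (1 - α) * LCOOT X Y Γ Γv := by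
      refine csInf_le ⟨0, ?_⟩ ⟨Γ, h, Γv, h', rfl⟩
      rintro v ⟨Γ, h, Γv, h', rfl⟩
      exact add_nonneg (mul_nonneg hα.1 (hG0 Γ h))
        (mul_nonneg (sub_nonneg.2 hα.2) (hL0 Γ h Γv h'))
    have h2 := mul_le_mul_of_nonneg_left (hGC Γ h) hα.1
    have h3 := mul_nonneg hα.1 (hL0 Γ h Γv h')
    linarith
  have t1 : Filter.Tendsto (fun α : ℝ => (1 - α) * COOTval X Y μ ν μ' ν')
      (nhdsWithin 0 (Set.Icc (0 : ℝ) 1)) (nhds (COOTval X Y μ ν μ' ν')) := by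
    have hc : Continuous (fun α : ℝ => (1 - α) * COOTval X Y μ ν μ' ν') := by fun_prop
    simpa using (hc.tendsto 0).mono_left nhdsWithin_le_nhds
  have t2 : Filter.Tendsto (fun α : ℝ => α * C + COOTval X Y μ ν μ' ν')
      (nhdsWithin 0 (Set.Icc (0 : ℝ) 1)) (nhds (COOTval X Y μ ν μ' ν')) := by
    have hc : Continuous (fun α : ℝ => α * C + COOTval X Y μ ν μ' ν') := by fun_prop
    simpa only [zero_mul, zero_add] using (hc.tendsto 0).mono_left nhdsWithin_le_nhds
  exact tendsto_of_tendsto_of_tendsto_of_le_of_le' t1 t2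
    (Filter.eventually_of_mem self_mem_nhdsWithin lower)
    (Filter.eventually_of_mem self_mem_nhdsWithin upper)
end

section
/- (GW part of the relaxed triangle inequality.) Let μ_x ∈ ℝ^n, μ_y ∈ ℝ^m, μ_z ∈ ℝ^p be probability vectors with all entries of μ_y strictly positive, let D_X ∈ ℝ^{n×n}, D_Y ∈ ℝ^{m×m}, D_Z ∈ ℝ^{p×p}, let π¹ ∈ Π(μ_x,μ_y), π² ∈ Π(μ_y,μ_z), and set P = π¹ · diag(μ_y)^{−1} · π². Then L_GW(P; D_X,D_Z) ≤ 2·( L_GW(π¹; D_X,D_Y) + L_GW(π²; D_Y,D_Z) ). -/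
open Finset Matrix

lemma LGW_eq_nested {n m : ℕ} (D : Matrix (Fin n) (Fin n) ℝ) (D' : Matrix (Fin m) (Fin m) ℝ)
    (Γ : Matrix (Fin n) (Fin m) ℝ) :
    LGW D D' Γ = ∑ i, ∑ j, (∑ k, ∑ l, (D i k - D' j l) ^ 2 * Γ k l) * Γ i j := by
  unfold LGW
  refine Finset.sum_congr rfl fun i _ => ?_
  rw [Finset.sum_comm]
  refine Finset.sum_congr rfl fun j _ => ?_
  rw [Finset.sum_mul]
  refine Finset.sum_congr rfl fun k _ => ?_
  rw [Finset.sum_mul]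
  refine Finset.sum_congr rfl fun l _ => ?_
  ring

/-- Weighted sum over triples. -/
def tripleSum {n m p : ℕ} (w F : Fin n → Fin m → Fin p → ℝ) : ℝ :=
  ∑ i, ∑ e, ∑ j, F i e j * w i e j

lemma tripleSum_mono {n m p : ℕ} (w F G : Fin n → Fin m → Fin p → ℝ)
    (hw : ∀ i e j, 0 ≤ w i e j) (h : ∀ i e j, F i e j ≤ G i e j) :
    tripleSum w F ≤ tripleSum w G :=
  Finset.sum_le_sum fun i _ => Finset.sum_le_sum fun e _ => Finset.sum_le_sum fun j _ =>
    mul_le_mul_of_nonneg_right (h i e j) (hw i e j)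

lemma tripleSum_lin {n m p : ℕ} (w F G : Fin n → Fin m → Fin p → ℝ) :
    tripleSum w (fun i e j => 2 * (F i e j + G i e j)) =
      2 * (tripleSum w F + tripleSum w G) := by
  unfold tripleSum
  simp only [← Finset.sum_add_distrib, Finset.mul_sum]
  refine Finset.sum_congr rfl fun i _ => Finset.sum_congr rfl fun e _ =>
    Finset.sum_congr rfl fun j _ => ?_
  ring

theorem gw_relaxed_triangle_part {n m p : ℕ}
    (μx : Fin n → ℝ) (μy : Fin m → ℝ) (μz : Fin p → ℝ)
    (hμx : IsProbVec μx) (hμy : IsProbVec μy) (hμz : IsProbVec μz)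
    (hμypos : ∀ e, 0 < μy e)
    (DX : Matrix (Fin n) (Fin n) ℝ) (DY : Matrix (Fin m) (Fin m) ℝ)
    (DZ : Matrix (Fin p) (Fin p) ℝ)
    (π₁ : Matrix (Fin n) (Fin m) ℝ) (π₂ : Matrix (Fin m) (Fin p) ℝ)
    (hπ₁ : π₁ ∈ Couplings μx μy) (hπ₂ : π₂ ∈ Couplings μy μz) :
    LGW DX DZ (Matrix.of fun i k => ∑ e, π₁ i e * π₂ e k / μy e) ≤
      2 * (LGW DX DY π₁ + LGW DY DZ π₂) := by
  obtain ⟨h1n, -, h1c⟩ := hπ₁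
  obtain ⟨h2n, h2r, -⟩ := hπ₂
  set w : Fin n → Fin m → Fin p → ℝ := fun i e j => π₁ i e * π₂ e j / μy e with hwdef
  have hw : ∀ i e j, 0 ≤ w i e j := fun i e j =>
    div_nonneg (mul_nonneg (h1n i e) (h2n e j)) (hμypos e).le
  have hA : ∀ F : Fin n → Fin p → ℝ,
      ∑ i, ∑ j, F i j * (Matrix.of fun i k => ∑ e, π₁ i e * π₂ e k / μy e) i j =
        tripleSum w (fun i _ j => F i j) := by
    intro F
    unfold tripleSum
    refine Finset.sum_congr rfl fun i _ => ?_
    rw [Finset.sum_comm]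
    refine Finset.sum_congr rfl fun j _ => ?_
    rw [Matrix.of_apply, Finset.mul_sum]
  have hB : ∀ F : Fin n → Fin m → ℝ,
      ∑ i, ∑ e, F i e * π₁ i e = tripleSum w (fun i e _ => F i e) := by
    intro F
    unfold tripleSum
    refine Finset.sum_congr rfl fun i _ => Finset.sum_congr rfl fun e _ => ?_
    rw [← Finset.mul_sum]
    simp only [hwdef]
    rw [← Finset.sum_div, ← Finset.mul_sum, h2r, mul_div_cancel_right₀ _ (hμypos e).ne']
  have hC : ∀ F : Fin m → Fin p → ℝ,
      ∑ e, ∑ j, F e j * π₂ e j = tripleSum w (fun _ e j => F e j) := by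
    intro F
    unfold tripleSum
    symm
    rw [Finset.sum_comm]
    refine Finset.sum_congr rfl fun e _ => ?_
    rw [Finset.sum_comm]
    refine Finset.sum_congr rfl fun j _ => ?_
    rw [← Finset.mul_sum]
    simp only [hwdef]
    rw [← Finset.sum_div, ← Finset.sum_mul, h1c, mul_div_cancel_left₀ _ (hμypos e).ne']
  simp only [LGW_eq_nested, hA, hB, hC]
  rw [← tripleSum_lin]
  refine tripleSum_mono w _ _ hw fun i e j => ?_
  rw [← tripleSum_lin]
  refine tripleSum_mono w _ _ hw fun k f l => ?_
  nlinarith [sq_nonneg ((DX i k - DY e f) - (DY e f - DZ j l))]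
end

section
/- (COOT part of the relaxed triangle inequality.) Let X ∈ ℝ^{n×d}, Y ∈ ℝ^{m×e}, Z ∈ ℝ^{p×f} be data matrices; let μ_x, μ_y, μ_z be probability vectors in ℝ^n, ℝ^m, ℝ^p and μ'_x, μ'_y, μ'_z probability vectors in ℝ^d, ℝ^e, ℝ^f, with all entries of μ_y and μ'_y strictly positive. Let π¹ ∈ Π(μ_x,μ_y), π² ∈ Π(μ_y,μ_z), γ¹ ∈ Π(μ'_x,μ'_y), γ² ∈ Π(μ'_y,μ'_z), and set P = π¹ · diag(μ_y)^{−1} · π² and Q = γ¹ · diag(μ'_y)^{−1} · γ². Then L_COOT(P,Q; X,Z) ≤ 2·( L_COOT(π¹,γ¹; X,Y) + L_COOT(π²,γ²; Y,Z) ). -/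
open Finset Matrix

theorem coot_aux_first {n m p d e f : ℕ}
    (F : Fin n → Fin m → Fin d → Fin e → ℝ)
    (w : Fin n → Fin m → Fin p → ℝ) (v : Fin d → Fin e → Fin f → ℝ) :
    ∑ i, ∑ j, ∑ a, ∑ b, F i j a b * (∑ k, w i j k) * (∑ c, v a b c) =
      ∑ i, ∑ j, ∑ k, ∑ a, ∑ b, ∑ c, F i j a b * w i j k * v a b c := by
  refine sum_congr rfl fun i _ => sum_congr rfl fun j _ => ?_
  rw [sum_comm]
  rw [sum_comm]
  conv_rhs => rw [sum_comm]
  refine sum_congr rfl fun a _ => ?_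
  conv_rhs => rw [sum_comm]
  refine sum_congr rfl fun b _ => ?_
  rw [mul_assoc, sum_mul_sum, mul_sum]
  refine sum_congr rfl fun k _ => ?_
  rw [mul_sum]
  exact sum_congr rfl fun c _ => by ring

theorem coot_aux_mid {n m p d e f : ℕ}
    (F : Fin n → Fin p → Fin d → Fin f → ℝ)
    (w : Fin n → Fin m → Fin p → ℝ) (v : Fin d → Fin e → Fin f → ℝ) :
    ∑ i, ∑ k, ∑ a, ∑ c, F i k a c * (∑ j, w i j k) * (∑ b, v a b c) =
      ∑ i, ∑ j, ∑ k, ∑ a, ∑ b, ∑ c, F i k a c * w i j k * v a b c := by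
  rw [coot_aux_first F (fun i k j => w i j k) (fun a c b => v a b c)]
  refine sum_congr rfl fun i _ => ?_
  rw [sum_comm]
  exact sum_congr rfl fun j _ => sum_congr rfl fun k _ => sum_congr rfl fun a _ => sum_comm

theorem coot_aux_last {n m p d e f : ℕ}
    (F : Fin m → Fin p → Fin e → Fin f → ℝ)
    (w : Fin n → Fin m → Fin p → ℝ) (v : Fin d → Fin e → Fin f → ℝ) :
    ∑ j, ∑ k, ∑ b, ∑ c, F j k b c * (∑ i, w i j k) * (∑ a, v a b c) =
      ∑ i, ∑ j, ∑ k, ∑ a, ∑ b, ∑ c, F j k b c * w i j k * v a b c := by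
  rw [coot_aux_first F (fun j k i => w i j k) (fun b c a => v a b c)]
  conv_rhs => rw [sum_comm]
  refine sum_congr rfl fun j _ => ?_
  conv_rhs => rw [sum_comm]
  refine sum_congr rfl fun k _ => sum_congr rfl fun i _ => ?_
  conv_rhs => rw [sum_comm]
  exact sum_congr rfl fun b _ => sum_comm

theorem coot_relaxed_triangle_part {n m p d e f : ℕ}
    (X : Matrix (Fin n) (Fin d) ℝ) (Y : Matrix (Fin m) (Fin e) ℝ)
    (Z : Matrix (Fin p) (Fin f) ℝ)
    (μx : Fin n → ℝ) (μy : Fin m → ℝ) (μz : Fin p → ℝ)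
    (μ'x : Fin d → ℝ) (μ'y : Fin e → ℝ) (μ'z : Fin f → ℝ)
    (hμx : IsProbVec μx) (hμy : IsProbVec μy) (hμz : IsProbVec μz)
    (hμ'x : IsProbVec μ'x) (hμ'y : IsProbVec μ'y) (hμ'z : IsProbVec μ'z)
    (hμypos : ∀ j, 0 < μy j) (hμ'ypos : ∀ j, 0 < μ'y j)
    (π₁ : Matrix (Fin n) (Fin m) ℝ) (π₂ : Matrix (Fin m) (Fin p) ℝ)
    (γ₁ : Matrix (Fin d) (Fin e) ℝ) (γ₂ : Matrix (Fin e) (Fin f) ℝ)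
    (hπ₁ : π₁ ∈ Couplings μx μy) (hπ₂ : π₂ ∈ Couplings μy μz)
    (hγ₁ : γ₁ ∈ Couplings μ'x μ'y) (hγ₂ : γ₂ ∈ Couplings μ'y μ'z) :
    LCOOT X Z (Matrix.of fun i k => ∑ j, π₁ i j * π₂ j k / μy j)
        (Matrix.of fun i k => ∑ j, γ₁ i j * γ₂ j k / μ'y j) ≤
      2 * (LCOOT X Y π₁ γ₁ + LCOOT Y Z π₂ γ₂) := by
  obtain ⟨p1, -, c1⟩ := hπ₁
  obtain ⟨p2, r2, -⟩ := hπ₂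
  obtain ⟨g1, -, d1⟩ := hγ₁
  obtain ⟨g2, s2, -⟩ := hγ₂
  have hw1 : ∀ i j, π₁ i j = ∑ k, π₁ i j * π₂ j k / μy j := fun i j => by
    rw [← sum_div, ← mul_sum, r2, mul_div_assoc, div_self (hμypos j).ne', mul_one]
  have hw2 : ∀ j k, π₂ j k = ∑ i, π₁ i j * π₂ j k / μy j := fun j k => by
    rw [← sum_div, ← sum_mul, c1, mul_div_assoc, mul_div_cancel₀ _ (hμypos j).ne']
  have hv1 : ∀ i j, γ₁ i j = ∑ k, γ₁ i j * γ₂ j k / μ'y j := fun i j => by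
    rw [← sum_div, ← mul_sum, s2, mul_div_assoc, div_self (hμ'ypos j).ne', mul_one]
  have hv2 : ∀ j k, γ₂ j k = ∑ i, γ₁ i j * γ₂ j k / μ'y j := fun j k => by
    rw [← sum_div, ← sum_mul, d1, mul_div_assoc, mul_div_cancel₀ _ (hμ'ypos j).ne']
  have hw : ∀ i j k, 0 ≤ π₁ i j * π₂ j k / μy j := fun i j k =>
    div_nonneg (mul_nonneg (p1 i j) (p2 j k)) (hμypos j).le
  have hv : ∀ i j k, 0 ≤ γ₁ i j * γ₂ j k / μ'y j := fun i j k =>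
    div_nonneg (mul_nonneg (g1 i j) (g2 j k)) (hμ'ypos j).le
  generalize hwd : (fun i j k => π₁ i j * π₂ j k / μy j) = w
  generalize hvd : (fun i j k => γ₁ i j * γ₂ j k / μ'y j) = v
  have ew : ∀ i j k, π₁ i j * π₂ j k / μy j = w i j k := fun i j k => by rw [← hwd]
  have ev : ∀ i j k, γ₁ i j * γ₂ j k / μ'y j = v i j k := fun i j k => by rw [← hvd]
  simp only [ew] at hw hw1 hw2
  simp only [ev] at hv hv1 hv2
  have e1 : LCOOT X Y π₁ γ₁ =
      ∑ i, ∑ j, ∑ k, ∑ a, ∑ b, ∑ c, (X i a - Y j b) ^ 2 * w i j k * v a b c := by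
    unfold LCOOT
    simp only [hw1, hv1]
    exact coot_aux_first (fun i j a b => (X i a - Y j b) ^ 2) w v
  have e2 : LCOOT Y Z π₂ γ₂ =
      ∑ i, ∑ j, ∑ k, ∑ a, ∑ b, ∑ c, (Y j b - Z k c) ^ 2 * w i j k * v a b c := by
    unfold LCOOT
    simp only [hw2, hv2]
    exact coot_aux_last (fun j k b c => (Y j b - Z k c) ^ 2) w v
  rw [e1, e2]
  unfold LCOOT
  simp only [Matrix.of_apply, ew, ev]
  rw [coot_aux_mid (fun i k a c => (X i a - Z k c) ^ 2) w v]
  simp only [← sum_add_distrib, mul_sum]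
  refine sum_le_sum fun i _ => sum_le_sum fun j _ => sum_le_sum fun k _ =>
    sum_le_sum fun a _ => sum_le_sum fun b _ => sum_le_sum fun c _ => ?_
  have h := mul_nonneg (hw i j k) (hv a b c)
  have h2 := mul_nonneg h (sq_nonneg ((X i a - Y j b) - (Y j b - Z k c)))
  nlinarith [h2]
end

section
/- (Relaxed triangle inequality for AGW; Proposition 1.2.) Let X ∈ ℝ^{n×d}, Z ∈ ℝ^{m×e}, and Y ∈ ℝ^{p×f} be data matrices with associated matrices D_X ∈ ℝ^{n×n}, D_Z ∈ ℝ^{m×m}, D_Y ∈ ℝ^{p×p}, and probability vectors μ_x ∈ ℝ^n, μ_z ∈ ℝ^m, μ_y ∈ ℝ^p for samples and μ'_x ∈ ℝ^d, μ'_z ∈ ℝ^e, μ'_y ∈ ℝ^f for features, where all entries of μ_y and μ'_y are strictly positive. Then for every α ∈ [0,1], AGW_α(X,Z) ≤ 2·( AGW_α(X,Y) + AGW_α(Y,Z) ). -/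
open Finset Matrix

noncomputable def glue {n p m : ℕ} (ν : Fin p → ℝ) (A : Matrix (Fin n) (Fin p) ℝ)
    (B : Matrix (Fin p) (Fin m) ℝ) : Matrix (Fin n) (Fin m) ℝ :=
  fun i k => ∑ j, A i j * B j k / ν j

lemma glue_sum_right {n p m : ℕ} {μ : Fin n → ℝ} {ν : Fin p → ℝ} {ρ : Fin m → ℝ}
    {A : Matrix (Fin n) (Fin p) ℝ} {B : Matrix (Fin p) (Fin m) ℝ}
    (hB : B ∈ Couplings ν ρ) (hν : ∀ j, 0 < ν j) (i : Fin n) (j : Fin p) :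
    ∑ k, A i j * B j k / ν j = A i j := by
  rw [← Finset.sum_div, ← Finset.mul_sum, hB.2.1 j]
  exact mul_div_cancel_right₀ _ (hν j).ne'

lemma glue_sum_left {n p m : ℕ} {μ : Fin n → ℝ} {ν : Fin p → ℝ}
    {A : Matrix (Fin n) (Fin p) ℝ} {B : Matrix (Fin p) (Fin m) ℝ}
    (hA : A ∈ Couplings μ ν) (hν : ∀ j, 0 < ν j) (j : Fin p) (k : Fin m) :
    ∑ i, A i j * B j k / ν j = B j k := by
  rw [← Finset.sum_div, ← Finset.sum_mul, hA.2.2 j]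
  exact mul_div_cancel_left₀ _ (hν j).ne'

lemma glue_mem {n p m : ℕ} {μ : Fin n → ℝ} {ν : Fin p → ℝ} {ρ : Fin m → ℝ}
    {A : Matrix (Fin n) (Fin p) ℝ} {B : Matrix (Fin p) (Fin m) ℝ}
    (hA : A ∈ Couplings μ ν) (hB : B ∈ Couplings ν ρ) (hν : ∀ j, 0 < ν j) :
    glue ν A B ∈ Couplings μ ρ := by
  refine ⟨fun i k => Finset.sum_nonneg fun j _ =>
    div_nonneg (mul_nonneg (hA.1 i j) (hB.1 j k)) (hν j).le, fun i => ?_, fun k => ?_⟩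
  · unfold glue
    rw [Finset.sum_comm, ← hA.2.1 i]
    exact Finset.sum_congr rfl fun j _ => glue_sum_right (μ := μ) hB hν i j
  · unfold glue
    rw [Finset.sum_comm, ← hB.2.2 k]
    exact Finset.sum_congr rfl fun j _ => glue_sum_left hA hν j k

/-- Gluing preserves a relaxed triangle inequality of costs. -/
lemma glue_cost {n p m : ℕ} {μ : Fin n → ℝ} {ν : Fin p → ℝ} {ρ : Fin m → ℝ}
    {A : Matrix (Fin n) (Fin p) ℝ} {B : Matrix (Fin p) (Fin m) ℝ}
    (hA : A ∈ Couplings μ ν) (hB : B ∈ Couplings ν ρ) (hν : ∀ j, 0 < ν j)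
    (c : Fin n → Fin m → ℝ) (c₁ : Fin n → Fin p → ℝ) (c₂ : Fin p → Fin m → ℝ)
    (h : ∀ i j k, c i k ≤ 2 * (c₁ i j + c₂ j k)) :
    ∑ i, ∑ k, c i k * glue ν A B i k ≤
      2 * (∑ i, ∑ j, c₁ i j * A i j + ∑ j, ∑ k, c₂ j k * B j k) := by
  have e₁ : ∑ i, ∑ j, c₁ i j * A i j =
      ∑ i, ∑ k, ∑ j, c₁ i j * (A i j * B j k / ν j) := by
    refine Finset.sum_congr rfl fun i _ => ?_
    rw [Finset.sum_comm]
    refine Finset.sum_congr rfl fun j _ => ?_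
    rw [← Finset.mul_sum, glue_sum_right (μ := μ) hB hν]
  have e₂ : ∑ j, ∑ k, c₂ j k * B j k =
      ∑ i, ∑ k, ∑ j, c₂ j k * (A i j * B j k / ν j) := by
    rw [Finset.sum_comm, Finset.sum_comm (s := (Finset.univ : Finset (Fin n)))]
    refine Finset.sum_congr rfl fun k _ => ?_
    rw [Finset.sum_comm]
    refine Finset.sum_congr rfl fun j _ => ?_
    rw [← Finset.mul_sum, glue_sum_left hA hν]
  rw [e₁, e₂]
  simp only [← Finset.sum_add_distrib, Finset.mul_sum, glue]
  refine Finset.sum_le_sum fun i _ => Finset.sum_le_sum fun k _ => Finset.sum_le_sum fun j _ => ?_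
  have hw : 0 ≤ A i j * B j k / ν j :=
    div_nonneg (mul_nonneg (hA.1 i j) (hB.1 j k)) (hν j).le
  nlinarith [mul_le_mul_of_nonneg_right (h i j k) hw]

lemma LCOOT_eq {n m d d' : ℕ} (X : Matrix (Fin n) (Fin d) ℝ) (Y : Matrix (Fin m) (Fin d') ℝ)
    (Γs : Matrix (Fin n) (Fin m) ℝ) (Γv : Matrix (Fin d) (Fin d') ℝ) :
    LCOOT X Y Γs Γv = ∑ i, ∑ j, (∑ k, ∑ l, (X i k - Y j l) ^ 2 * Γv k l) * Γs i j := by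
  unfold LCOOT
  simp only [Finset.sum_mul]
  refine Finset.sum_congr rfl fun i _ => Finset.sum_congr rfl fun j _ =>
    Finset.sum_congr rfl fun k _ => Finset.sum_congr rfl fun l _ => by ring

lemma LGW_eq {n m : ℕ} (DX : Matrix (Fin n) (Fin n) ℝ) (DY : Matrix (Fin m) (Fin m) ℝ)
    (Γ : Matrix (Fin n) (Fin m) ℝ) : LGW DX DY Γ = LCOOT DX DY Γ Γ := by
  unfold LGW LCOOT
  exact Finset.sum_congr rfl fun i _ => Finset.sum_comm

lemma LCOOT_nonneg {n m d d' : ℕ} (X : Matrix (Fin n) (Fin d) ℝ)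
    (Y : Matrix (Fin m) (Fin d') ℝ)
    {Γs : Matrix (Fin n) (Fin m) ℝ} {Γv : Matrix (Fin d) (Fin d') ℝ}
    (hs : ∀ i j, 0 ≤ Γs i j) (hv : ∀ i j, 0 ≤ Γv i j) : 0 ≤ LCOOT X Y Γs Γv :=
  Finset.sum_nonneg fun i _ => Finset.sum_nonneg fun j _ => Finset.sum_nonneg fun k _ =>
    Finset.sum_nonneg fun l _ => mul_nonneg (mul_nonneg (sq_nonneg _) (hs i j)) (hv k l)

lemma LCOOT_glue {n m p d e f : ℕ}
    (X : Matrix (Fin n) (Fin d) ℝ) (Z : Matrix (Fin m) (Fin e) ℝ)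
    (Y : Matrix (Fin p) (Fin f) ℝ)
    {μ : Fin n → ℝ} {ν : Fin p → ℝ} {ρ : Fin m → ℝ}
    {A : Matrix (Fin n) (Fin p) ℝ} {B : Matrix (Fin p) (Fin m) ℝ}
    {μ' : Fin d → ℝ} {ν' : Fin f → ℝ} {ρ' : Fin e → ℝ}
    {A' : Matrix (Fin d) (Fin f) ℝ} {B' : Matrix (Fin f) (Fin e) ℝ}
    (hA : A ∈ Couplings μ ν) (hB : B ∈ Couplings ν ρ) (hν : ∀ j, 0 < ν j)
    (hA' : A' ∈ Couplings μ' ν') (hB' : B' ∈ Couplings ν' ρ') (hν' : ∀ j, 0 < ν' j) :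
    LCOOT X Z (glue ν A B) (glue ν' A' B') ≤ 2 * (LCOOT X Y A A' + LCOOT Y Z B B') := by
  simp only [LCOOT_eq]
  refine glue_cost hA hB hν _ _ _ fun i j k => glue_cost hA' hB' hν' _ _ _ fun a b c => ?_
  nlinarith [sq_nonneg ((X i a - Y j b) - (Y j b - Z k c))]

lemma couplings_nonempty {n m : ℕ} {μ : Fin n → ℝ} {ν : Fin m → ℝ}
    (hμ : IsProbVec μ) (hν : IsProbVec ν) : (Couplings μ ν).Nonempty := by
  refine ⟨fun i j => μ i * ν j, fun i j => mul_nonneg (hμ.1 i) (hν.1 j), fun i => ?_, fun j => ?_⟩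
  · rw [← Finset.mul_sum, hν.2, mul_one]
  · rw [← Finset.sum_mul, hμ.2, one_mul]

lemma AGW_approx {n m d d' : ℕ} (α : ℝ) (X : Matrix (Fin n) (Fin d) ℝ)
    (Y : Matrix (Fin m) (Fin d') ℝ) (DX : Matrix (Fin n) (Fin n) ℝ)
    (DY : Matrix (Fin m) (Fin m) ℝ) {μ : Fin n → ℝ} {ν : Fin m → ℝ}
    {μ' : Fin d → ℝ} {ν' : Fin d' → ℝ} (hμ : IsProbVec μ) (hν : IsProbVec ν)
    (hμ' : IsProbVec μ') (hν' : IsProbVec ν') {ε : ℝ} (hε : 0 < ε) :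
    ∃ Γs ∈ Couplings μ ν, ∃ Γv ∈ Couplings μ' ν',
      α * LGW DX DY Γs + (1 - α) * LCOOT X Y Γs Γv < AGWval α X Y DX DY μ ν μ' ν' + ε := by
  obtain ⟨G, hG⟩ := couplings_nonempty hμ hν
  obtain ⟨G', hG'⟩ := couplings_nonempty hμ' hν'
  obtain ⟨v, ⟨Γs, hs, Γv, hv, rfl⟩, hlt⟩ := exists_lt_of_csInf_lt
    (s := {v : ℝ | ∃ Γs ∈ Couplings μ ν, ∃ Γv ∈ Couplings μ' ν',
      v = α * LGW DX DY Γs + (1 - α) * LCOOT X Y Γs Γv})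
    ⟨_, G, hG, G', hG', rfl⟩ (lt_add_of_pos_right (AGWval α X Y DX DY μ ν μ' ν') hε)
  exact ⟨Γs, hs, Γv, hv, hlt⟩

theorem agw_relaxed_triangle {n m p d e f : ℕ} (α : ℝ) (hα : α ∈ Set.Icc (0 : ℝ) 1)
    (X : Matrix (Fin n) (Fin d) ℝ) (Z : Matrix (Fin m) (Fin e) ℝ)
    (Y : Matrix (Fin p) (Fin f) ℝ)
    (DX : Matrix (Fin n) (Fin n) ℝ) (DZ : Matrix (Fin m) (Fin m) ℝ)
    (DY : Matrix (Fin p) (Fin p) ℝ)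
    (μx : Fin n → ℝ) (μz : Fin m → ℝ) (μy : Fin p → ℝ)
    (μ'x : Fin d → ℝ) (μ'z : Fin e → ℝ) (μ'y : Fin f → ℝ)
    (hμx : IsProbVec μx) (hμz : IsProbVec μz) (hμy : IsProbVec μy)
    (hμ'x : IsProbVec μ'x) (hμ'z : IsProbVec μ'z) (hμ'y : IsProbVec μ'y)
    (hμypos : ∀ j, 0 < μy j) (hμ'ypos : ∀ j, 0 < μ'y j) :
    AGWval α X Z DX DZ μx μz μ'x μ'z ≤
      2 * (AGWval α X Y DX DY μx μy μ'x μ'y + AGWval α Y Z DY DZ μy μz μ'y μ'z) := by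
  have h0 : 0 ≤ α := hα.1
  have h1 : 0 ≤ 1 - α := sub_nonneg.2 hα.2
  refine le_of_forall_pos_le_add fun ε hε => ?_
  obtain ⟨A, hA, A', hA', h₁⟩ := AGW_approx α X Y DX DY hμx hμy hμ'x hμ'y
    (show 0 < ε / 4 by positivity)
  obtain ⟨B, hB, B', hB', h₂⟩ := AGW_approx α Y Z DY DZ hμy hμz hμ'y hμ'z
    (show 0 < ε / 4 by positivity)
  have hle : AGWval α X Z DX DZ μx μz μ'x μ'z ≤
      α * LGW DX DZ (glue μy A B) + (1 - α) * LCOOT X Z (glue μy A B) (glue μ'y A' B') := by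
    refine csInf_le ⟨0, ?_⟩ ⟨_, glue_mem hA hB hμypos, _, glue_mem hA' hB' hμ'ypos, rfl⟩
    rintro v ⟨Γs, hs, Γv, hv, rfl⟩
    rw [LGW_eq]
    exact add_nonneg (mul_nonneg h0 (LCOOT_nonneg _ _ hs.1 hs.1))
      (mul_nonneg h1 (LCOOT_nonneg _ _ hs.1 hv.1))
  have k₁ := mul_le_mul_of_nonneg_left
    (LCOOT_glue DX DZ DY hA hB hμypos hA hB hμypos) h0
  have k₂ := mul_le_mul_of_nonneg_left
    (LCOOT_glue X Z Y hA hB hμypos hA' hB' hμ'ypos) h1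
  rw [LGW_eq] at hle h₁ h₂
  linarith
end

section
/- (COOT loss under translation, pointwise.) Let X ∈ ℝ^{n×d}, Y ∈ ℝ^{m×d'}, c ∈ ℝ, and let μ ∈ ℝ^n, ν ∈ ℝ^m, μ' ∈ ℝ^d, ν' ∈ ℝ^{d'} be probability vectors. Write Y + c for the matrix with entries Y_{jl} + c. Then for every Γs ∈ Π(μ,ν) and Γv ∈ Π(μ',ν'), L_COOT(Γs,Γv; X, Y + c) = L_COOT(Γs,Γv; X, Y) − 2c·(μᵀ X μ' − νᵀ Y ν') + c². -/
open Finset Matrix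

theorem coot_loss_translation_pointwise {n m d d' : ℕ}
    (X : Matrix (Fin n) (Fin d) ℝ) (Y : Matrix (Fin m) (Fin d') ℝ) (c : ℝ)
    (μ : Fin n → ℝ) (ν : Fin m → ℝ) (μ' : Fin d → ℝ) (ν' : Fin d' → ℝ)
    (hμ : IsProbVec μ) (hν : IsProbVec ν) (hμ' : IsProbVec μ') (hν' : IsProbVec ν')
    (Γs : Matrix (Fin n) (Fin m) ℝ) (Γv : Matrix (Fin d) (Fin d') ℝ)
    (hΓs : Γs ∈ Couplings μ ν) (hΓv : Γv ∈ Couplings μ' ν') :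
    LCOOT X (Matrix.of fun j l => Y j l + c) Γs Γv =
      LCOOT X Y Γs Γv -
        2 * c * ((∑ i, ∑ k, μ i * X i k * μ' k) - ∑ j, ∑ l, ν j * Y j l * ν' l) +
        c ^ 2 := by
  obtain ⟨-, hsr, hsc⟩ := hΓs
  obtain ⟨-, hvr, hvc⟩ := hΓv
  have hX : ∑ i, ∑ j, ∑ k, ∑ l, X i k * Γs i j * Γv k l = ∑ i, ∑ k, μ i * X i k * μ' k := by
    refine Finset.sum_congr rfl fun i _ => ?_
    rw [Finset.sum_comm]
    refine Finset.sum_congr rfl fun k _ => ?_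
    simp_rw [← Finset.mul_sum, hvr, ← Finset.sum_mul, ← Finset.mul_sum, hsr]
    ring
  have hY : ∑ i, ∑ j, ∑ k, ∑ l, Y j l * Γs i j * Γv k l = ∑ j, ∑ l, ν j * Y j l * ν' l := by
    rw [Finset.sum_comm]
    refine Finset.sum_congr rfl fun j _ => ?_
    have h : ∀ i, ∑ k, ∑ l, Y j l * Γs i j * Γv k l = ∑ l, Y j l * Γs i j * ν' l := by
      intro i
      rw [Finset.sum_comm]
      simp_rw [← Finset.mul_sum, hvc]
    simp_rw [h]
    rw [Finset.sum_comm]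
    refine Finset.sum_congr rfl fun l _ => ?_
    simp_rw [← Finset.sum_mul, ← Finset.mul_sum, hsc]
    ring
  have h1 : ∑ i, ∑ j, ∑ k, ∑ l, Γs i j * Γv k l = 1 := by
    simp_rw [← Finset.mul_sum, hvr, hμ'.2, mul_one, hsr, hμ.2]
  rw [← hX, ← hY]
  have e : c ^ 2 = c ^ 2 * ∑ i, ∑ j, ∑ k, ∑ l, Γs i j * Γv k l := by rw [h1, mul_one]
  rw [e]
  unfold LCOOT
  simp only [Finset.mul_sum, ← Finset.sum_sub_distrib, ← Finset.sum_add_distrib, Matrix.of_apply]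
  refine Finset.sum_congr rfl fun i _ => Finset.sum_congr rfl fun j _ =>
    Finset.sum_congr rfl fun k _ => Finset.sum_congr rfl fun l _ => ?_
  ring
end

section
/- (COOT is weakly invariant to translation.) Let X ∈ ℝ^{n×d}, Y ∈ ℝ^{m×d'}, c ∈ ℝ, and let μ ∈ ℝ^n, ν ∈ ℝ^m, μ' ∈ ℝ^d, ν' ∈ ℝ^{d'} be probability vectors. Write Y + c for the matrix with entries Y_{jl} + c. Then COOT(X, Y + c) = COOT(X, Y) − 2c·(μᵀ X μ' − νᵀ Y ν') + c². In particular the COOT value shifts by a constant under translation and the set of optimal coupling pairs is preserved. -/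
open Finset Matrix

lemma LCOOT_shift {n m d d' : ℕ}
    (X : Matrix (Fin n) (Fin d) ℝ) (Y : Matrix (Fin m) (Fin d') ℝ) (c : ℝ)
    (μ : Fin n → ℝ) (ν : Fin m → ℝ) (μ' : Fin d → ℝ) (ν' : Fin d' → ℝ)
    (hμ : IsProbVec μ) (hμ' : IsProbVec μ')
    (Γs : Matrix (Fin n) (Fin m) ℝ) (Γv : Matrix (Fin d) (Fin d') ℝ)
    (hs : Γs ∈ Couplings μ ν) (hv : Γv ∈ Couplings μ' ν') :
    LCOOT X (Matrix.of fun j l => Y j l + c) Γs Γv = LCOOT X Y Γs Γv +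
      (- (2 * c * ((∑ i, ∑ k, μ i * X i k * μ' k) - ∑ j, ∑ l, ν j * Y j l * ν' l)) + c ^ 2) := by
  obtain ⟨-, hs1, hs2⟩ := hs
  obtain ⟨-, hv1, hv2⟩ := hv
  have hA : ∑ i, ∑ j, ∑ k, ∑ l, X i k * Γs i j * Γv k l = ∑ i, ∑ k, μ i * X i k * μ' k := by
    refine Finset.sum_congr rfl fun i _ => ?_
    rw [Finset.sum_comm]
    refine Finset.sum_congr rfl fun k _ => ?_
    rw [← hs1 i, ← hv1 k]
    simp_rw [← Finset.mul_sum, ← Finset.sum_mul, ← Finset.mul_sum]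
    ring
  have hB : ∑ i, ∑ j, ∑ k, ∑ l, Y j l * Γs i j * Γv k l = ∑ j, ∑ l, ν j * Y j l * ν' l := by
    rw [Finset.sum_comm]
    refine Finset.sum_congr rfl fun j _ => ?_
    have h1 : ∀ i, ∑ k, ∑ l, Y j l * Γs i j * Γv k l = Γs i j * ∑ l, Y j l * ν' l := by
      intro i
      rw [Finset.sum_comm, Finset.mul_sum]
      refine Finset.sum_congr rfl fun l _ => ?_
      rw [← Finset.mul_sum, hv2 l]
      ring
    simp_rw [h1]
    rw [← Finset.sum_mul, hs2 j, Finset.mul_sum]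
    exact Finset.sum_congr rfl fun l _ => by ring
  have hC : ∑ i, ∑ j, ∑ k, ∑ l, Γs i j * Γv k l = 1 := by
    simp_rw [← Finset.mul_sum, hv1, hμ'.2, mul_one, hs1, hμ.2]
  rw [← hA, ← hB, ← mul_one (c ^ 2), ← hC]
  unfold LCOOT
  simp only [Matrix.of_apply, ← Finset.sum_sub_distrib, Finset.mul_sum, ← Finset.sum_neg_distrib,
    ← Finset.sum_add_distrib]
  refine Finset.sum_congr rfl fun i _ => Finset.sum_congr rfl fun j _ =>
    Finset.sum_congr rfl fun k _ => Finset.sum_congr rfl fun l _ => ?_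
  ring

lemma Couplings_nonempty {n m : ℕ} (μ : Fin n → ℝ) (ν : Fin m → ℝ)
    (hμ : IsProbVec μ) (hν : IsProbVec ν) : (Couplings μ ν).Nonempty := by
  refine ⟨Matrix.of fun i j => μ i * ν j, fun i j => mul_nonneg (hμ.1 i) (hν.1 j), ?_, ?_⟩
  · intro i
    simp [← Finset.mul_sum, hν.2]
  · intro j
    simp [← Finset.sum_mul, hμ.2]

theorem coot_weakly_invariant_translation {n m d d' : ℕ}
    (X : Matrix (Fin n) (Fin d) ℝ) (Y : Matrix (Fin m) (Fin d') ℝ) (c : ℝ)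
    (μ : Fin n → ℝ) (ν : Fin m → ℝ) (μ' : Fin d → ℝ) (ν' : Fin d' → ℝ)
    (hμ : IsProbVec μ) (hν : IsProbVec ν) (hμ' : IsProbVec μ') (hν' : IsProbVec ν') :
    COOTval X (Matrix.of fun j l => Y j l + c) μ ν μ' ν' =
      COOTval X Y μ ν μ' ν' -
        2 * c * ((∑ i, ∑ k, μ i * X i k * μ' k) - ∑ j, ∑ l, ν j * Y j l * ν' l) +
        c ^ 2 := by
  obtain ⟨G, hG⟩ := Couplings_nonempty μ ν hμ hν
  obtain ⟨H, hH⟩ := Couplings_nonempty μ' ν' hμ' hν'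
  have hshift := LCOOT_shift X Y c μ ν μ' ν' hμ hμ'
  generalize hK : (- (2 * c * ((∑ i, ∑ k, μ i * X i k * μ' k) - ∑ j, ∑ l, ν j * Y j l * ν' l))
    + c ^ 2) = K at hshift
  rw [sub_eq_add_neg, add_assoc, hK]
  unfold COOTval
  have hne : {v : ℝ | ∃ Γs ∈ Couplings μ ν, ∃ Γv ∈ Couplings μ' ν',
      v = LCOOT X Y Γs Γv}.Nonempty := ⟨_, G, hG, H, hH, rfl⟩
  have hbd : BddBelow {v : ℝ | ∃ Γs ∈ Couplings μ ν, ∃ Γv ∈ Couplings μ' ν',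
      v = LCOOT X Y Γs Γv} := by
    refine ⟨0, ?_⟩
    rintro v ⟨Γs, hs, Γv, hv, rfl⟩
    exact Finset.sum_nonneg fun i _ => Finset.sum_nonneg fun j _ => Finset.sum_nonneg fun k _ =>
      Finset.sum_nonneg fun l _ => mul_nonneg (mul_nonneg (sq_nonneg _) (hs.1 i j)) (hv.1 k l)
  have h := (OrderIso.addRight K).map_csInf' hne hbd
  rw [OrderIso.addRight_apply] at h
  rw [h]
  congr 1
  ext v
  constructor
  · rintro ⟨Γs, hs, Γv, hv, rfl⟩
    exact ⟨_, ⟨Γs, hs, Γv, hv, rfl⟩, (hshift Γs Γv hs hv).symm⟩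
  · rintro ⟨_, ⟨Γs, hs, Γv, hv, rfl⟩, rfl⟩
    exact ⟨Γs, hs, Γv, hv, (hshift Γs Γv hs hv).symm⟩
end

section
/- (AGW is weakly invariant to translation — value shift; Theorem 1.1.) Let X ∈ ℝ^{n×d}, Y ∈ ℝ^{m×d'}, c ∈ ℝ, D_X ∈ ℝ^{n×n}, D_Y ∈ ℝ^{m×m}, and let μ ∈ ℝ^n, ν ∈ ℝ^m, μ' ∈ ℝ^d, ν' ∈ ℝ^{d'} be probability vectors. Write Y + c for the matrix with entries Y_{jl} + c, and let AGW_α(X, Y + c) denote the AGW value computed with the same matrices D_X and D_Y. Then for every α ∈ [0,1], AGW_α(X, Y + c) = AGW_α(X, Y) + (1−α)·(c² − 2c·(μᵀ X μ' − νᵀ Y ν')), i.e., the AGW value shifts by a constant depending only on c, α, X, Y and the marginals. -/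
open Finset Matrix

/-- Shift of the COOT loss under translation of `Y`. -/
theorem lcoot_shift_aux {n m d d' : ℕ}
    (X : Matrix (Fin n) (Fin d) ℝ) (Y : Matrix (Fin m) (Fin d') ℝ) (c : ℝ)
    (μ : Fin n → ℝ) (ν : Fin m → ℝ) (μ' : Fin d → ℝ) (ν' : Fin d' → ℝ)
    (hμ : IsProbVec μ) (hμ' : IsProbVec μ')
    (Γs : Matrix (Fin n) (Fin m) ℝ) (hs : Γs ∈ Couplings μ ν)
    (Γv : Matrix (Fin d) (Fin d') ℝ) (hv : Γv ∈ Couplings μ' ν') :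
    LCOOT X (Matrix.of fun j l => Y j l + c) Γs Γv = LCOOT X Y Γs Γv +
      (c ^ 2 -
          2 * c * ((∑ i, ∑ k, μ i * X i k * μ' k) - ∑ j, ∑ l, ν j * Y j l * ν' l)) := by
  obtain ⟨-, hs1, hs2⟩ := hs
  obtain ⟨-, hv1, hv2⟩ := hv
  have h1 : ∑ i, ∑ j, ∑ k, ∑ l, Γs i j * Γv k l = 1 := by
    simp only [← Finset.mul_sum, hv1, hμ'.2, mul_one, hs1, hμ.2]
  have h2 : ∑ i, ∑ j, ∑ k, ∑ l, Γs i j * X i k * Γv k l = ∑ i, ∑ k, μ i * X i k * μ' k := by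
    refine Finset.sum_congr rfl fun i _ => ?_
    rw [Finset.sum_comm]
    refine Finset.sum_congr rfl fun k _ => ?_
    simp only [← Finset.mul_sum, ← Finset.sum_mul, hv1, hs1]
  have h3 : ∑ i, ∑ j, ∑ k, ∑ l, Γs i j * Y j l * Γv k l = ∑ j, ∑ l, ν j * Y j l * ν' l := by
    rw [Finset.sum_comm]
    refine Finset.sum_congr rfl fun j _ => ?_
    have : ∀ i, ∑ k, ∑ l, Γs i j * Y j l * Γv k l = ∑ l, Γs i j * Y j l * ν' l := by
      intro i
      rw [Finset.sum_comm]
      simp only [← Finset.mul_sum, hv2]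
    simp only [this]
    rw [Finset.sum_comm]
    simp only [← Finset.sum_mul, hs2]
  have key : LCOOT X (Matrix.of fun j l => Y j l + c) Γs Γv = LCOOT X Y Γs Γv +
      (c ^ 2 * (∑ i, ∑ j, ∑ k, ∑ l, Γs i j * Γv k l) -
        2 * c * ((∑ i, ∑ j, ∑ k, ∑ l, Γs i j * X i k * Γv k l) -
          ∑ i, ∑ j, ∑ k, ∑ l, Γs i j * Y j l * Γv k l)) := by
    simp only [LCOOT, Matrix.of_apply, Finset.mul_sum, ← Finset.sum_sub_distrib,
      ← Finset.sum_add_distrib]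
    refine Finset.sum_congr rfl fun i _ => Finset.sum_congr rfl fun j _ =>
      Finset.sum_congr rfl fun k _ => Finset.sum_congr rfl fun l _ => ?_
    ring
  rw [key, h1, h2, h3, mul_one]

/-- The product coupling. -/
theorem couplings_nonempty_aux {n m : ℕ} (μ : Fin n → ℝ) (ν : Fin m → ℝ)
    (hμ : IsProbVec μ) (hν : IsProbVec ν) : ∃ Γ, Γ ∈ Couplings μ ν := by
  refine ⟨Matrix.of fun i j => μ i * ν j, fun i j => mul_nonneg (hμ.1 i) (hν.1 j), ?_, ?_⟩
  · intro i
    simp only [Matrix.of_apply, ← Finset.mul_sum, hν.2, mul_one]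
  · intro j
    simp only [Matrix.of_apply, ← Finset.sum_mul, hμ.2, one_mul]

theorem agw_weakly_invariant_translation_value {n m d d' : ℕ}
    (α : ℝ) (hα : α ∈ Set.Icc (0 : ℝ) 1)
    (X : Matrix (Fin n) (Fin d) ℝ) (Y : Matrix (Fin m) (Fin d') ℝ) (c : ℝ)
    (DX : Matrix (Fin n) (Fin n) ℝ) (DY : Matrix (Fin m) (Fin m) ℝ)
    (μ : Fin n → ℝ) (ν : Fin m → ℝ) (μ' : Fin d → ℝ) (ν' : Fin d' → ℝ)
    (hμ : IsProbVec μ) (hν : IsProbVec ν) (hμ' : IsProbVec μ') (hν' : IsProbVec ν') :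
    AGWval α X (Matrix.of fun j l => Y j l + c) DX DY μ ν μ' ν' =
      AGWval α X Y DX DY μ ν μ' ν' +
        (1 - α) * (c ^ 2 -
          2 * c * ((∑ i, ∑ k, μ i * X i k * μ' k) - ∑ j, ∑ l, ν j * Y j l * ν' l)) := by
  obtain ⟨Gs, hGs⟩ := couplings_nonempty_aux μ ν hμ hν
  obtain ⟨Gv, hGv⟩ := couplings_nonempty_aux μ' ν' hμ' hν'
  set K := c ^ 2 -
    2 * c * ((∑ i, ∑ k, μ i * X i k * μ' k) - ∑ j, ∑ l, ν j * Y j l * ν' l) with hK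
  have hshift := fun Γs hs Γv hv =>
    lcoot_shift_aux X Y c μ ν μ' ν' hμ hμ' Γs hs Γv hv
  rw [← hK] at hshift
  have hbdd : ∀ Z : Matrix (Fin m) (Fin d') ℝ,
      BddBelow {v : ℝ | ∃ Γs ∈ Couplings μ ν, ∃ Γv ∈ Couplings μ' ν',
        v = α * LGW DX DY Γs + (1 - α) * LCOOT X Z Γs Γv} := by
    intro Z
    refine ⟨0, ?_⟩
    rintro v ⟨Γs, hs, Γv, hv, rfl⟩
    have a1 : 0 ≤ LGW DX DY Γs :=
      Finset.sum_nonneg fun i _ => Finset.sum_nonneg fun k _ => Finset.sum_nonneg fun j _ =>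
        Finset.sum_nonneg fun l _ =>
          mul_nonneg (mul_nonneg (sq_nonneg _) (hs.1 _ _)) (hs.1 _ _)
    have a2 : 0 ≤ LCOOT X Z Γs Γv :=
      Finset.sum_nonneg fun i _ => Finset.sum_nonneg fun k _ => Finset.sum_nonneg fun j _ =>
        Finset.sum_nonneg fun l _ =>
          mul_nonneg (mul_nonneg (sq_nonneg _) (hs.1 _ _)) (hv.1 _ _)
    exact add_nonneg (mul_nonneg hα.1 a1) (mul_nonneg (sub_nonneg.2 hα.2) a2)
  unfold AGWval
  apply le_antisymm
  · rw [← sub_le_iff_le_add]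
    refine le_csInf ⟨_, Gs, hGs, Gv, hGv, rfl⟩ ?_
    rintro v ⟨Γs, hs, Γv, hv, rfl⟩
    rw [sub_le_iff_le_add]
    refine csInf_le (hbdd _) ⟨Γs, hs, Γv, hv, ?_⟩
    rw [hshift Γs hs Γv hv]
    ring
  · refine le_csInf ⟨_, Gs, hGs, Gv, hGv, rfl⟩ ?_
    rintro v ⟨Γs, hs, Γv, hv, rfl⟩
    rw [← le_sub_iff_add_le]
    refine csInf_le (hbdd _) ⟨Γs, hs, Γv, hv, ?_⟩
    rw [hshift Γs hs Γv hv]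
    ring
end

section
/- (COOT vanishes on a column permutation.) Let X ∈ ℝ^{n×d}, let σ be a permutation of [d], and define Y ∈ ℝ^{n×d} by Y_{i,σ(k)} = X_{i,k} for all i ∈ [n], k ∈ [d]. Let μ ∈ ℝ^n and μ' ∈ ℝ^d be probability vectors and define ν' ∈ ℝ^d by ν'_{σ(k)} = μ'_k. Then the couplings Γs = diag(μ) ∈ Π(μ,μ) and Γv ∈ ℝ^{d×d}, defined by Γv_{k,l} = μ'_k if l = σ(k) and 0 otherwise, satisfy Γv ∈ Π(μ',ν') and L_COOT(Γs,Γv; X,Y) = 0; consequently COOT(X,Y) = 0 (with sample marginals μ, μ and feature marginals μ', ν'). -/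
open Finset Matrix

theorem coot_vanishes_on_column_permutation {n d : ℕ}
    (X : Matrix (Fin n) (Fin d) ℝ) (σ : Equiv.Perm (Fin d))
    (Y : Matrix (Fin n) (Fin d) ℝ) (hY : ∀ i k, Y i (σ k) = X i k)
    (μ : Fin n → ℝ) (μ' : Fin d → ℝ) (hμ : IsProbVec μ) (hμ' : IsProbVec μ')
    (ν' : Fin d → ℝ) (hν' : ∀ k, ν' (σ k) = μ' k) :
    Matrix.diagonal μ ∈ Couplings μ μ ∧
      (Matrix.of fun k l => if l = σ k then μ' k else 0) ∈ Couplings μ' ν' ∧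
      LCOOT X Y (Matrix.diagonal μ) (Matrix.of fun k l => if l = σ k then μ' k else 0) = 0 ∧
      COOTval X Y μ μ μ' ν' = 0 := by
  have h1 : Matrix.diagonal μ ∈ Couplings μ μ := by
    refine ⟨fun i j => ?_, fun i => ?_, fun j => ?_⟩
    · rw [Matrix.diagonal_apply]
      split_ifs
      · exact hμ.1 i
      · exact le_rfl
    · simp [Matrix.diagonal_apply]
    · simp [Matrix.diagonal_apply]
  have h2 : (Matrix.of fun k l => if l = σ k then μ' k else 0) ∈ Couplings μ' ν' := by
    refine ⟨fun i j => ?_, fun i => ?_, fun j => ?_⟩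
    · rw [Matrix.of_apply]
      split_ifs
      · exact hμ'.1 i
      · exact le_rfl
    · simp
    · obtain ⟨k, rfl⟩ := σ.surjective j
      simp [hν']
  have h3 : LCOOT X Y (Matrix.diagonal μ)
      (Matrix.of fun k l => if l = σ k then μ' k else 0) = 0 := by
    unfold LCOOT
    refine Finset.sum_eq_zero fun i _ => Finset.sum_eq_zero fun j _ =>
      Finset.sum_eq_zero fun k _ => Finset.sum_eq_zero fun l _ => ?_
    by_cases hij : i = j
    · by_cases hl : l = σ k
      · subst hij hl
        simp [hY]
      · simp [hl]
    · simp [Matrix.diagonal_apply_ne _ hij]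
  refine ⟨h1, h2, h3, ?_⟩
  refine IsLeast.csInf_eq ⟨⟨_, h1, _, h2, h3.symm⟩, ?_⟩
  rintro v ⟨Γs, hs, Γv, hv, rfl⟩
  exact Finset.sum_nonneg fun i _ => Finset.sum_nonneg fun j _ =>
    Finset.sum_nonneg fun k _ => Finset.sum_nonneg fun l _ =>
      mul_nonneg (mul_nonneg (sq_nonneg _) (hs.1 i j)) (hv.1 k l)
end

section
/- (Theorem 1.2: AGW vanishes on a column permutation.) Let X ∈ ℝ^{n×d}, let σ be a permutation of [d], and define Y ∈ ℝ^{n×d} by Y_{i,σ(k)} = X_{i,k}. Let μ ∈ ℝ^n and μ' ∈ ℝ^d be probability vectors, set ν = μ, define ν' ∈ ℝ^d by ν'_{σ(k)} = μ'_k, and suppose D_Y = D_X for a given matrix D_X ∈ ℝ^{n×n} (the intra-domain matrix is unchanged since Y permutes the features of the same samples). Then for every α ∈ [0,1], AGW_α(X,Y) = 0. -/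
open Finset Matrix

theorem agw_vanishes_on_column_permutation {n d : ℕ}
    (α : ℝ) (hα : α ∈ Set.Icc (0 : ℝ) 1)
    (X : Matrix (Fin n) (Fin d) ℝ) (σ : Equiv.Perm (Fin d))
    (Y : Matrix (Fin n) (Fin d) ℝ) (hY : ∀ i k, Y i (σ k) = X i k)
    (DX : Matrix (Fin n) (Fin n) ℝ)
    (μ : Fin n → ℝ) (μ' : Fin d → ℝ) (hμ : IsProbVec μ) (hμ' : IsProbVec μ')
    (ν' : Fin d → ℝ) (hν' : ∀ k, ν' (σ k) = μ' k) :
    AGWval α X Y DX DX μ μ μ' ν' = 0 := by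
  have hα0 := hα.1
  have hα1 : 0 ≤ 1 - α := sub_nonneg.2 hα.2
  unfold AGWval
  apply IsLeast.csInf_eq
  constructor
  · refine ⟨fun i j => if i = j then μ i else 0, ⟨?_, ?_, ?_⟩,
      fun k l => if σ k = l then μ' k else 0, ⟨?_, ?_, ?_⟩, ?_⟩
    · intro i j
      dsimp only
      split_ifs
      · exact hμ.1 i
      · exact le_rfl
    · intro i
      simp
    · intro j
      simp
    · intro i j
      dsimp only
      split_ifs
      · exact hμ'.1 i
      · exact le_rfl
    · intro i
      simp
    · intro j
      obtain ⟨k, rfl⟩ := σ.surjective j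
      simp [hν']
    · have h1 : LGW DX DX (fun i j => if i = j then μ i else 0) = 0 := by
        unfold LGW
        refine Finset.sum_eq_zero fun i _ => Finset.sum_eq_zero fun k _ =>
          Finset.sum_eq_zero fun j _ => Finset.sum_eq_zero fun l _ => ?_
        by_cases hij : i = j
        · by_cases hkl : k = l
          · subst hij hkl
            simp
          · simp [hkl]
        · simp [hij]
      have h2 : LCOOT X Y (fun i j => if i = j then μ i else 0)
          (fun k l => if σ k = l then μ' k else 0) = 0 := by
        unfold LCOOT
        refine Finset.sum_eq_zero fun i _ => Finset.sum_eq_zero fun j _ =>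
          Finset.sum_eq_zero fun k _ => Finset.sum_eq_zero fun l _ => ?_
        by_cases hij : i = j
        · by_cases hkl : σ k = l
          · subst hij hkl
            simp [hY]
          · simp [hkl]
        · simp [hij]
      rw [h1, h2]
      simp
  · rintro v ⟨Γs, hs, Γv, hv, rfl⟩
    have h1 : 0 ≤ LGW DX DX Γs := by
      unfold LGW
      exact Finset.sum_nonneg fun i _ => Finset.sum_nonneg fun k _ =>
        Finset.sum_nonneg fun j _ => Finset.sum_nonneg fun l _ =>
          mul_nonneg (mul_nonneg (sq_nonneg _) (hs.1 i j)) (hs.1 k l)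
    have h2 : 0 ≤ LCOOT X Y Γs Γv := by
      unfold LCOOT
      exact Finset.sum_nonneg fun i _ => Finset.sum_nonneg fun j _ =>
        Finset.sum_nonneg fun k _ => Finset.sum_nonneg fun l _ =>
          mul_nonneg (mul_nonneg (sq_nonneg _) (hs.1 i j)) (hv.1 k l)
    positivity
end

section
/- (Sandwich bounds for AGW; Proposition 1.1, quantitative form.) Let Γs₁ ∈ Π(μ,ν) be a minimizer of L_GW and let (Γs₀,Γv₀) ∈ Π(μ,ν) × Π(μ',ν') be a minimizer of L_COOT. Then for every α ∈ [0,1], max( α·GW(D_X,D_Y,μ,ν), (1−α)·COOT(X,Y) ) ≤ AGW_α(X,Y) ≤ min( α·GW(D_X,D_Y,μ,ν) + (1−α)·L_COOT(Γs₁,Γv₀), (1−α)·COOT(X,Y) + α·L_GW(Γs₀) ). -/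
open Finset Matrix

theorem LGW_nonneg_aux {n m : ℕ} (DX : Matrix (Fin n) (Fin n) ℝ)
    (DY : Matrix (Fin m) (Fin m) ℝ) (Γ : Matrix (Fin n) (Fin m) ℝ)
    (h : ∀ i j, 0 ≤ Γ i j) : 0 ≤ LGW DX DY Γ := by
  unfold LGW
  exact Finset.sum_nonneg fun i _ => Finset.sum_nonneg fun k _ => Finset.sum_nonneg fun j _ =>
    Finset.sum_nonneg fun l _ => mul_nonneg (mul_nonneg (sq_nonneg _) (h i j)) (h k l)

theorem LCOOT_nonneg_aux {n m d d' : ℕ} (X : Matrix (Fin n) (Fin d) ℝ)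
    (Y : Matrix (Fin m) (Fin d') ℝ)
    (Γs : Matrix (Fin n) (Fin m) ℝ) (Γv : Matrix (Fin d) (Fin d') ℝ)
    (h : ∀ i j, 0 ≤ Γs i j) (h' : ∀ i j, 0 ≤ Γv i j) : 0 ≤ LCOOT X Y Γs Γv := by
  unfold LCOOT
  exact Finset.sum_nonneg fun i _ => Finset.sum_nonneg fun j _ => Finset.sum_nonneg fun k _ =>
    Finset.sum_nonneg fun l _ => mul_nonneg (mul_nonneg (sq_nonneg _) (h i j)) (h' k l)

theorem agw_sandwich_bounds {n m d d' : ℕ} (α : ℝ) (hα : α ∈ Set.Icc (0 : ℝ) 1)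
    (X : Matrix (Fin n) (Fin d) ℝ) (Y : Matrix (Fin m) (Fin d') ℝ)
    (DX : Matrix (Fin n) (Fin n) ℝ) (DY : Matrix (Fin m) (Fin m) ℝ)
    (μ : Fin n → ℝ) (ν : Fin m → ℝ) (μ' : Fin d → ℝ) (ν' : Fin d' → ℝ)
    (hμ : IsProbVec μ) (hν : IsProbVec ν) (hμ' : IsProbVec μ') (hν' : IsProbVec ν')
    (Γs₁ : Matrix (Fin n) (Fin m) ℝ) (hΓs₁ : Γs₁ ∈ Couplings μ ν)
    (hminGW : LGW DX DY Γs₁ = GWval DX DY μ ν)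
    (Γs₀ : Matrix (Fin n) (Fin m) ℝ) (Γv₀ : Matrix (Fin d) (Fin d') ℝ)
    (hΓs₀ : Γs₀ ∈ Couplings μ ν) (hΓv₀ : Γv₀ ∈ Couplings μ' ν')
    (hminCOOT : LCOOT X Y Γs₀ Γv₀ = COOTval X Y μ ν μ' ν') :
    max (α * GWval DX DY μ ν) ((1 - α) * COOTval X Y μ ν μ' ν') ≤
        AGWval α X Y DX DY μ ν μ' ν' ∧
      AGWval α X Y DX DY μ ν μ' ν' ≤
        min (α * GWval DX DY μ ν + (1 - α) * LCOOT X Y Γs₁ Γv₀)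
          ((1 - α) * COOTval X Y μ ν μ' ν' + α * LGW DX DY Γs₀) := by
  obtain ⟨h0, h1⟩ := hα
  have h1' : 0 ≤ 1 - α := by linarith
  have hup : ∀ Γs ∈ Couplings μ ν, ∀ Γv ∈ Couplings μ' ν',
      AGWval α X Y DX DY μ ν μ' ν' ≤ α * LGW DX DY Γs + (1 - α) * LCOOT X Y Γs Γv := by
    intro Γs hs Γv hv
    refine csInf_le ⟨0, ?_⟩ ⟨Γs, hs, Γv, hv, rfl⟩
    rintro v ⟨A, hA, B, hB, rfl⟩
    exact add_nonneg (mul_nonneg h0 (LGW_nonneg_aux _ _ _ hA.1))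
      (mul_nonneg h1' (LCOOT_nonneg_aux _ _ _ _ hA.1 hB.1))
  constructor
  · refine le_csInf ⟨_, Γs₀, hΓs₀, Γv₀, hΓv₀, rfl⟩ ?_
    rintro v ⟨A, hA, B, hB, rfl⟩
    have hG : GWval DX DY μ ν ≤ LGW DX DY A := by
      refine csInf_le ⟨0, ?_⟩ ⟨A, hA, rfl⟩
      rintro v ⟨C, hC, rfl⟩
      exact LGW_nonneg_aux _ _ _ hC.1
    have hC : COOTval X Y μ ν μ' ν' ≤ LCOOT X Y A B := by
      refine csInf_le ⟨0, ?_⟩ ⟨A, hA, B, hB, rfl⟩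
      rintro v ⟨C, hC, E, hE, rfl⟩
      exact LCOOT_nonneg_aux _ _ _ _ hC.1 hE.1
    have a1 := mul_le_mul_of_nonneg_left hG h0
    have a2 := mul_le_mul_of_nonneg_left hC h1'
    have a3 := mul_nonneg h0 (LGW_nonneg_aux DX DY A hA.1)
    have a4 := mul_nonneg h1' (LCOOT_nonneg_aux X Y A B hA.1 hB.1)
    exact max_le (by linarith) (by linarith)
  · have b1 := hup Γs₁ hΓs₁ Γv₀ hΓv₀
    have b2 := hup Γs₀ hΓs₀ Γv₀ hΓv₀
    rw [← hminGW, ← hminCOOT]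
    exact le_min b1 (by linarith)
end
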